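/- Existence and uniqueness of the Hess connection on (𝒢_{n,p}(𝕂), ω): with ω = δα_{(H₀,N₀)}, L = {(x,u) : u strictly upper triangular by p×p blocks} and L' = {(0,u) : u lower triangular by p×p blocks}, there exists a unique bilinear map ∇ : 𝒢_{n,p}(𝕂) × 𝒢_{n,p}(𝕂) → 𝒢_{n,p}(𝕂) such that: (torsion-free) ∇_a b − ∇_b a = [a,b] for all a, b; (symplectic) ω(∇_a b, c) + ω(b, ∇_a c) = 0 for all a, b, c; (L parallel) ∇_a b ∈ L for all a ∈ 𝒢_{n,p}(𝕂) and b ∈ L; (L' parallel) ∇_a b' ∈ L' for all a ∈ 𝒢_{n,p}(𝕂) and b' ∈ L'. -/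

import Mathlib

open Matrix

/-- The underlying space of the Lie algebra `𝒢_{n,p}(𝕂) = M_{n,p}(𝕂) × gl(n,𝕂)`. -/
abbrev GA (𝕂 : Type) [RCLike 𝕂] (n p : ℕ) : Type :=
  Matrix (Fin n) (Fin p) 𝕂 × Matrix (Fin n) (Fin n) 𝕂

/-- The Lie bracket `[(x,u),(y,v)] = (u·y − v·x, u·v − v·u)` of `𝒢_{n,p}(𝕂)`. -/
def bkt {𝕂 : Type} [RCLike 𝕂] {n p : ℕ} (a b : GA 𝕂 n p) : GA 𝕂 n p :=
  (a.2 * b.1 - b.2 * a.1, a.2 * b.2 - b.2 * a.2)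

/-- The block row `H₀ = (0,…,0,I_p) ∈ M_{p,n}(𝕂)`. -/
def H0 (𝕂 : Type) [RCLike 𝕂] (n p : ℕ) : Matrix (Fin p) (Fin n) 𝕂 :=
  Matrix.of fun i j => if (j : ℕ) = n - p + (i : ℕ) then 1 else 0

/-- The block subdiagonal matrix `N₀ ∈ gl(n,𝕂)`. -/
def N0 (𝕂 : Type) [RCLike 𝕂] (n p : ℕ) : Matrix (Fin n) (Fin n) 𝕂 :=
  Matrix.of fun i j => if (i : ℕ) = (j : ℕ) + p then 1 else 0

/-- `L = {(x,u) : u` strictly upper triangular by `p×p` blocks`}` as a set. -/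
def Lset (𝕂 : Type) [RCLike 𝕂] (n p : ℕ) : Set (GA 𝕂 n p) :=
  {a | ∀ i j : Fin n, (j : ℕ) / p ≤ (i : ℕ) / p → a.2 i j = 0}

/-- `L' = {(0,u) : u` lower triangular by `p×p` blocks`}` as a set. -/
def Lset' (𝕂 : Type) [RCLike 𝕂] (n p : ℕ) : Set (GA 𝕂 n p) :=
  {a | a.1 = 0 ∧ ∀ i j : Fin n, (i : ℕ) / p < (j : ℕ) / p → a.2 i j = 0}

theorem hess_aux {K V : Type*} [Field K] [AddCommGroup V] [Module K V] [FiniteDimensional K V]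
    (B : V →ₗ[K] V →ₗ[K] V) (w : V →ₗ[K] V →ₗ[K] K)
    (hB : ∀ a b, B a b = - B b a)
    (hw : ∀ a b, w a b = - w b a)
    (hnd : ∀ a, (∀ b, w a b = 0) → a = 0)
    (hcl : ∀ a b c, w (B a b) c + w (B b c) a + w (B c a) b = 0)
    (L M : Set V) (P Q : V →ₗ[K] V)
    (hP : ∀ x, P x ∈ L) (hQ : ∀ x, Q x ∈ M) (hPQ : ∀ x, P x + Q x = x)
    (hQL : ∀ x ∈ L, Q x = 0) (hPM : ∀ x ∈ M, P x = 0)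
    (hL : ∀ x ∈ L, ∀ y ∈ L, w x y = 0) (hM : ∀ x ∈ M, ∀ y ∈ M, w x y = 0)
    (hLB : ∀ x ∈ L, ∀ y ∈ L, B x y ∈ L) (hMB : ∀ x ∈ M, ∀ y ∈ M, B x y ∈ M) :
    ∃! D : V →ₗ[K] V →ₗ[K] V,
      (∀ a b, D a b - D b a = B a b) ∧
      (∀ a b c, w (D a b) c + w b (D a c) = 0) ∧
      (∀ a, ∀ b ∈ L, D a b ∈ L) ∧ (∀ a, ∀ b ∈ M, D a b ∈ M) := by
  have memL : ∀ x, Q x = 0 → x ∈ L := by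
    intro x hx
    have h := hPQ x
    rw [hx, add_zero] at h
    rw [← h]; exact hP x
  have memM : ∀ x, P x = 0 → x ∈ M := by
    intro x hx
    have h := hPQ x
    rw [hx, zero_add] at h
    rw [← h]; exact hQ x
  have wP : ∀ x c, w (P x) c = w x (Q c) := by
    intro x c
    have h1 : w (P x) c = w (P x) (P c) + w (P x) (Q c) := by rw [← map_add, hPQ]
    have h2 : w x (Q c) = w (P x) (Q c) + w (Q x) (Q c) := by
      rw [← LinearMap.add_apply, ← map_add, hPQ]
    rw [h1, h2, hL _ (hP x) _ (hP c), hM _ (hQ x) _ (hQ c)]; ring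
  have wQ : ∀ x c, w (Q x) c = w x (P c) := by
    intro x c
    rw [hw, hw x, wP]
  have orthL : ∀ x, (∀ c ∈ L, w x c = 0) → x ∈ L := by
    intro x hx
    refine memL _ (hnd _ fun c => ?_)
    rw [wQ]; exact hx _ (hP c)
  have orthM : ∀ x, (∀ c ∈ M, w x c = 0) → x ∈ M := by
    intro x hx
    refine memM _ (hnd _ fun c => ?_)
    rw [wP]; exact hx _ (hQ c)
  have hinj : Function.Injective w := by
    rw [← LinearMap.ker_eq_bot, LinearMap.ker_eq_bot']
    intro a ha
    exact hnd a fun b => by rw [ha]; rfl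
  let e : V ≃ₗ[K] Module.Dual K V :=
    LinearEquiv.ofInjectiveOfFinrankEq w hinj (by rw [Subspace.dual_finrank_eq])
  have he : ∀ v, e v = w v := fun v => rfl
  let S : V → V → V := fun a b => Q (B (P a) (Q b)) + P (B (Q a) (P b))
  let T : V → V → Module.Dual K V := fun a b =>
    w (S a b) - ((w b).comp (Q ∘ₗ (B (P a)) ∘ₗ Q) + (w b).comp (P ∘ₗ (B (Q a)) ∘ₗ P))
  let D : V →ₗ[K] V →ₗ[K] V := LinearMap.mk₂ K (fun a b => e.symm (T a b))
    (by intro a a' b; rw [← map_add]; congr 1; ext c; simp [T, S]; ring)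
    (by intro r a b; rw [← map_smul]; congr 1; ext c; simp [T, S]; ring)
    (by intro a b b'; rw [← map_add]; congr 1; ext c; simp [T, S]; ring)
    (by intro r a b; rw [← map_smul]; congr 1; ext c; simp [T, S]; ring)
  have hD : ∀ a b c, w (D a b) c = w (S a b) c - w b (S a c) := by
    intro a b c
    have : w (D a b) = T a b := by
      rw [← he]; simp [D]
    rw [this]; simp [T, S]
  have SL : ∀ a, ∀ b ∈ L, S a b ∈ L := by
    intro a b hb
    simp only [S, hQL b hb, map_zero, zero_add]; exact hP _
  have SM : ∀ a, ∀ b ∈ M, S a b ∈ M := by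
    intro a b hb
    simp only [S, hPM b hb, map_zero, add_zero]; exact hQ _
  refine existsUnique_of_exists_of_unique ⟨D, ?_, ?_, ?_, ?_⟩ ?_
  · intro a b
    rw [← sub_eq_zero]
    refine hnd _ fun c => ?_
    simp only [map_sub, LinearMap.sub_apply, hD]
    have e1 : ∀ x y z, w (S x y) z = w (B (P x) (Q y)) (P z) + w (B (Q x) (P y)) (Q z) := by
      intro x y z
      simp only [S, map_add, LinearMap.add_apply, wP, wQ]
    have e2 : ∀ x y z, w y (S x z) = - w (B (P x) (Q z)) (P y) - w (B (Q x) (P z)) (Q y) := by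
      intro x y z
      rw [hw, e1]; ring
    rw [e1, e1, e2, e2]
    have e3 : w (B a b) c = w (B (P a + Q a) (P b + Q b)) (P c + Q c) := by simp only [hPQ]
    rw [e3]
    simp only [map_add, LinearMap.add_apply]
    have z1 := hL _ (hLB _ (hP a) _ (hP b)) _ (hP c)
    have z2 := hM _ (hMB _ (hQ a) _ (hQ b)) _ (hQ c)
    have c1 := hcl (P a) (P b) (Q c)
    have c2 := hcl (Q a) (Q b) (P c)
    rw [hB (Q c) (P a), map_neg, LinearMap.neg_apply] at c1
    rw [hB (P c) (Q a), map_neg, LinearMap.neg_apply] at c2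
    rw [hB (P b) (Q a), hB (Q b) (P a)]
    simp only [map_neg, LinearMap.neg_apply]
    linear_combination -z1 - z2 - c1 - c2
  · intro a b c
    rw [hw b, hD, hD, hw c, hw b]; ring
  · intro a b hb
    refine orthL _ fun c hc => ?_
    rw [hD, hL _ (SL a b hb) _ hc, hL _ hb _ (SL a c hc), sub_zero]
  · intro a b hb
    refine orthM _ fun c hc => ?_
    rw [hD, hM _ (SM a b hb) _ hc, hM _ hb _ (SM a c hc), sub_zero]
  · have key : ∀ D1 D2 : V →ₗ[K] V →ₗ[K] V,
      ((∀ a b, D1 a b - D1 b a = B a b) ∧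
      (∀ a b c, w (D1 a b) c + w b (D1 a c) = 0) ∧
      (∀ a, ∀ b ∈ L, D1 a b ∈ L) ∧ (∀ a, ∀ b ∈ M, D1 a b ∈ M)) → 
      ((∀ a b, D2 a b - D2 b a = B a b) ∧
      (∀ a b c, w (D2 a b) c + w b (D2 a c) = 0) ∧
      (∀ a, ∀ b ∈ L, D2 a b ∈ L) ∧ (∀ a, ∀ b ∈ M, D2 a b ∈ M)) → D1 = D2 := by
      intro D1 D2 h1 h2
      obtain ⟨t1, s1, l1, m1⟩ := h1
      obtain ⟨t2, s2, l2, m2⟩ := h2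
      obtain ⟨E, hE⟩ : ∃ E, E = D1 - D2 := ⟨_, rfl⟩
      have hE' : ∀ a b, E a b = D1 a b - D2 a b := by intro a b; rw [hE]; rfl
      have es : ∀ a b, E a b = E b a := by
        intro a b
        have := (t1 a b).trans (t2 a b).symm
        rw [hE', hE', sub_eq_sub_iff_sub_eq_sub, this]
      have ew : ∀ a b c, w (E a b) c = - w b (E a c) := by
        intro a b c
        have h1 := s1 a b c
        have h2 := s2 a b c
        simp only [hE', map_sub, LinearMap.sub_apply]
        linear_combination h1 - h2
      have eL : ∀ a, ∀ b ∈ L, Q (E a b) = 0 := by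
        intro a b hb
        rw [hE', map_sub, hQL _ (l1 a b hb), hQL _ (l2 a b hb), sub_zero]
      have eM : ∀ a, ∀ b ∈ M, P (E a b) = 0 := by
        intro a b hb
        rw [hE', map_sub, hPM _ (m1 a b hb), hPM _ (m2 a b hb), sub_zero]
      have z1 : ∀ a ∈ L, ∀ b ∈ M, E a b = 0 := by
        intro a ha b hb
        rw [← hPQ (E a b), eM a b hb, es, eL b a ha, add_zero]
      have z2 : ∀ a ∈ M, ∀ b ∈ L, E a b = 0 := by
        intro a ha b hb
        rw [es]; exact z1 b hb a ha
      have z3 : ∀ a ∈ L, ∀ b ∈ L, E a b = 0 := by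
        intro a ha b hb
        refine hnd _ fun c => ?_
        rw [← hPQ c, map_add, hL _ (memL _ (eL a b hb)) _ (hP c), ew, z1 a ha _ (hQ c)]
        simp
      have z4 : ∀ a ∈ M, ∀ b ∈ M, E a b = 0 := by
        intro a ha b hb
        refine hnd _ fun c => ?_
        rw [← hPQ c, map_add, hM _ (memM _ (eM a b hb)) _ (hQ c), ew, z2 a ha _ (hP c)]
        simp
      rw [← sub_eq_zero, ← hE]
      ext a b
      rw [← hPQ a, ← hPQ b]
      simp only [map_add, LinearMap.add_apply, z1 _ (hP _) _ (hQ _), z2 _ (hQ _) _ (hP _),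
        z3 _ (hP _) _ (hP _), z4 _ (hQ _) _ (hQ _)]
      simp
    exact key

theorem N0_trace {𝕂 : Type} [RCLike 𝕂] {n p : ℕ} (hp : 1 ≤ p) (u : Matrix (Fin n) (Fin n) 𝕂)
    (h : ∀ i j : Fin n, (j : ℕ) = i + p → u i j = 0) : trace (N0 𝕂 n p * u) = 0 := by
  simp only [trace, diag, Matrix.mul_apply, N0, Matrix.of_apply]
  refine Finset.sum_eq_zero fun i _ => Finset.sum_eq_zero fun j _ => ?_
  split_ifs with hij
  · rw [h j i hij, mul_zero]
  · simp

theorem N0_mul {𝕂 : Type} [RCLike 𝕂] {n p : ℕ} (u : Matrix (Fin n) (Fin n) 𝕂)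
    (i l j : Fin n) (h : (i : ℕ) = l + p) : (N0 𝕂 n p * u) i j = u l j := by
  rw [Matrix.mul_apply, Finset.sum_eq_single l]
  · simp [N0, h]
  · intro b _ hb
    have : ¬ ((i : ℕ) = b + p) := fun h' => hb (Fin.ext (by omega))
    simp [N0, this]
  · simp

theorem N0_mul' {𝕂 : Type} [RCLike 𝕂] {n p : ℕ} (u : Matrix (Fin n) (Fin n) 𝕂)
    (i j : Fin n) (h : (i : ℕ) < p) : (N0 𝕂 n p * u) i j = 0 := by
  rw [Matrix.mul_apply]
  refine Finset.sum_eq_zero fun b _ => ?_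
  have : ¬ ((i : ℕ) = b + p) := by omega
  simp [N0, this]

theorem mul_N0 {𝕂 : Type} [RCLike 𝕂] {n p : ℕ} (u : Matrix (Fin n) (Fin n) 𝕂)
    (i l j : Fin n) (h : (l : ℕ) = j + p) : (u * N0 𝕂 n p) i j = u i l := by
  rw [Matrix.mul_apply, Finset.sum_eq_single l]
  · simp [N0, h]
  · intro b _ hb
    have : ¬ ((b : ℕ) = j + p) := fun h' => hb (Fin.ext (by omega))
    simp [N0, this]
  · simp

theorem mul_N0' {𝕂 : Type} [RCLike 𝕂] {n p : ℕ} (u : Matrix (Fin n) (Fin n) 𝕂)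
    (i j : Fin n) (h : n ≤ (j : ℕ) + p) : (u * N0 𝕂 n p) i j = 0 := by
  rw [Matrix.mul_apply]
  refine Finset.sum_eq_zero fun b _ => ?_
  have : ¬ ((b : ℕ) = j + p) := by omega
  simp [N0, this]

theorem H0_mul {𝕂 : Type} [RCLike 𝕂] {n p q : ℕ} (u : Matrix (Fin n) (Fin q) 𝕂)
    (c : Fin p) (l : Fin n) (j : Fin q) (h : (l : ℕ) = n - p + c) :
    (H0 𝕂 n p * u) c j = u l j := by
  rw [Matrix.mul_apply, Finset.sum_eq_single l]
  · simp [H0, h]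
  · intro b _ hb
    have : ¬ ((b : ℕ) = n - p + c) := fun h' => hb (Fin.ext (by omega))
    simp [H0, this]
  · simp

theorem mul_H0 {𝕂 : Type} [RCLike 𝕂] {n p q : ℕ} (x : Matrix (Fin q) (Fin p) 𝕂)
    (i : Fin q) (c : Fin p) (j : Fin n) (h : (j : ℕ) = n - p + c) :
    (x * H0 𝕂 n p) i j = x i c := by
  rw [Matrix.mul_apply, Finset.sum_eq_single c]
  · simp [H0, h]
  · intro b _ hb
    have : ¬ ((j : ℕ) = n - p + b) := fun h' => hb (Fin.ext (by omega))
    simp [H0, this]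
  · simp

theorem mul_H0' {𝕂 : Type} [RCLike 𝕂] {n p q : ℕ} (x : Matrix (Fin q) (Fin p) 𝕂)
    (i : Fin q) (j : Fin n) (h : (j : ℕ) < n - p) :
    (x * H0 𝕂 n p) i j = 0 := by
  rw [Matrix.mul_apply]
  refine Finset.sum_eq_zero fun b _ => ?_
  have : ¬ ((j : ℕ) = n - p + b) := by omega
  simp [H0, this]

theorem nondeg_aux {𝕂 : Type} [RCLike 𝕂] {p k n : ℕ} (hp : 1 ≤ p) (hk : 1 ≤ k)
    (hn : n = k * p) (x : Matrix (Fin n) (Fin p) 𝕂) (u : Matrix (Fin n) (Fin n) 𝕂)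
    (h1 : H0 𝕂 n p * u = 0) (h2 : N0 𝕂 n p * u - u * N0 𝕂 n p = x * H0 𝕂 n p) :
    x = 0 ∧ u = 0 := by
  have hpn : p ≤ n := by rw [hn]; exact Nat.le_mul_of_pos_left p hk
  have h2' : ∀ i j, (N0 𝕂 n p * u) i j - (u * N0 𝕂 n p) i j = (x * H0 𝕂 n p) i j := by
    intro i j
    rw [← h2]; rfl
  have F0 : ∀ i j : Fin n, n ≤ (i : ℕ) + p → u i j = 0 := by
    intro i j hi
    rw [← H0_mul u (⟨i - (n - p), by omega⟩ : Fin p) i j (by simp; omega), h1]; rfl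
  have F1 : ∀ i j i' j' : Fin n, (i' : ℕ) = i + p → (j' : ℕ) = j + p → u i j = u i' j' := by
    intro i j i' j' hi hj
    have := h2' i' j
    rw [N0_mul u i' i j hi, mul_N0 u i' j' j hj, mul_H0' x i' j (by omega)] at this
    exact sub_eq_zero.1 this
  have F2 : ∀ i j : Fin n, (i : ℕ) < p → p ≤ (j : ℕ) → u i j = 0 := by
    intro i j hi hj
    have := h2' i (⟨j - p, by omega⟩ : Fin n)
    rw [N0_mul' u i _ hi, mul_N0 u i j _ (by simp; omega), mul_H0' x i _ (by simp; omega)] at this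
    simpa using this
  have up : ∀ m, ∀ i j : Fin n, (i : ℕ) ≤ m → (i : ℕ) / p < (j : ℕ) / p → u i j = 0 := by
    intro m
    induction m using Nat.strong_induction_on with
    | _ m ih =>
    intro i j him hij
    have hj : p ≤ (j : ℕ) := by
      by_contra hc
      rw [Nat.div_eq_of_lt (by omega : (j : ℕ) < p)] at hij
      exact absurd hij (Nat.not_lt_zero _)
    by_cases hi : (i : ℕ) < p
    · exact F2 i j hi hj
    · push Not at hi
      rw [← F1 ⟨i - p, by omega⟩ ⟨j - p, by omega⟩ i j (by simp; omega) (by simp; omega)]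
      refine ih (i - p) (by omega) _ _ le_rfl ?_
      have a1 := Nat.div_eq_sub_div (by omega : 0 < p) hi
      have a2 := Nat.div_eq_sub_div (by omega : 0 < p) hj
      simp only
      omega
  have down : ∀ m, ∀ i j : Fin n, n - (i : ℕ) ≤ m → (j : ℕ) / p ≤ (i : ℕ) / p → u i j = 0 := by
    intro m
    induction m using Nat.strong_induction_on with
    | _ m ih =>
    intro i j him hij
    by_cases hi : n ≤ (i : ℕ) + p
    · exact F0 i j hi
    · push Not at hi
      have b1 : ((i : ℕ) + p) / p < k := by
        rw [Nat.div_lt_iff_lt_mul (by omega)]; omega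
      have a1 := Nat.add_div_right (i : ℕ) (by omega : 0 < p)
      have a2 := Nat.add_div_right (j : ℕ) (by omega : 0 < p)
      have b2 : (j : ℕ) + p < n := by
        refine lt_of_lt_of_eq ?_ hn.symm
        rw [← Nat.div_lt_iff_lt_mul (by omega)]; omega
      rw [F1 i j ⟨i + p, by omega⟩ ⟨j + p, b2⟩ rfl rfl]
      refine ih (n - (i + p)) (by omega) _ _ le_rfl ?_
      simp only
      omega
  have hu : u = 0 := by
    ext i j
    rcases lt_or_ge ((i : ℕ) / p) ((j : ℕ) / p) with h | h
    · exact up _ i j le_rfl h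
    · exact down _ i j le_rfl h
  refine ⟨?_, hu⟩
  ext i c
  have := h2' i ⟨n - p + c, by omega⟩
  rw [mul_H0 x i c _ rfl, hu] at this
  simpa using this.symm

theorem bkt_jacobi {𝕂 : Type} [RCLike 𝕂] {n p : ℕ} (a b c : GA 𝕂 n p) :
    bkt (bkt a b) c + bkt (bkt b c) a + bkt (bkt c a) b = 0 := by
  refine Prod.ext ?_ ?_
  · simp only [bkt, Prod.fst_add, Prod.fst_zero, Matrix.mul_sub, Matrix.sub_mul, Matrix.mul_assoc]
    abel
  · simp only [bkt, Prod.snd_add, Prod.snd_zero, Matrix.mul_sub, Matrix.sub_mul, Matrix.mul_assoc]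
    abel

theorem up_mul {𝕂 : Type} [RCLike 𝕂] {n p : ℕ} (u v : Matrix (Fin n) (Fin n) 𝕂)
    (hu : ∀ i j : Fin n, (j : ℕ) / p ≤ (i : ℕ) / p → u i j = 0)
    (hv : ∀ i j : Fin n, (j : ℕ) / p ≤ (i : ℕ) / p → v i j = 0) (i j : Fin n)
    (h : (j : ℕ) / p ≤ (i : ℕ) / p + 1) : (u * v) i j = 0 := by
  rw [Matrix.mul_apply]
  refine Finset.sum_eq_zero fun l _ => ?_
  by_cases hl : (l : ℕ) / p ≤ (i : ℕ) / p
  · rw [hu i l hl, zero_mul]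
  · rw [hv l j (by omega), mul_zero]

theorem low_mul {𝕂 : Type} [RCLike 𝕂] {n p : ℕ} (u v : Matrix (Fin n) (Fin n) 𝕂)
    (hu : ∀ i j : Fin n, (i : ℕ) / p < (j : ℕ) / p → u i j = 0)
    (hv : ∀ i j : Fin n, (i : ℕ) / p < (j : ℕ) / p → v i j = 0) (i j : Fin n)
    (h : (i : ℕ) / p < (j : ℕ) / p) : (u * v) i j = 0 := by
  rw [Matrix.mul_apply]
  refine Finset.sum_eq_zero fun l _ => ?_
  by_cases hl : (i : ℕ) / p < (l : ℕ) / p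
  · rw [hu i l hl, zero_mul]
  · rw [hv l j (by omega), mul_zero]

theorem H0_up {𝕂 : Type} [RCLike 𝕂] {p k n : ℕ} (hp : 1 ≤ p) (hk : 1 ≤ k)
    (hn : n = k * p) (u : Matrix (Fin n) (Fin n) 𝕂)
    (hu : ∀ i j : Fin n, (j : ℕ) / p ≤ (i : ℕ) / p → u i j = 0) : H0 𝕂 n p * u = 0 := by
  have hpn : p ≤ n := by rw [hn]; exact Nat.le_mul_of_pos_left p hk
  ext c j
  rw [H0_mul u c ⟨n - p + c, by omega⟩ j rfl]
  refine hu _ _ ?_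
  have h1 : (j : ℕ) / p < k := by
    rw [Nat.div_lt_iff_lt_mul (by omega), ← hn]; exact j.2
  have h2 : k - 1 ≤ (n - p + c) / p := by
    rw [Nat.le_div_iff_mul_le (by omega), Nat.sub_mul]; omega
  simp only
  omega

/-- The bracket as a bilinear map. -/
noncomputable def bktL (𝕂 : Type) [RCLike 𝕂] (n p : ℕ) :
    GA 𝕂 n p →ₗ[𝕂] GA 𝕂 n p →ₗ[𝕂] GA 𝕂 n p :=
  LinearMap.mk₂ 𝕂 bkt
    (by intro a a' b; refine Prod.ext ?_ ?_ <;> simp [bkt, Matrix.mul_add, Matrix.add_mul] <;> abel)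
    (by intro r a b; refine Prod.ext ?_ ?_ <;> simp [bkt, smul_sub])
    (by intro a a' b; refine Prod.ext ?_ ?_ <;> simp [bkt, Matrix.mul_add, Matrix.add_mul] <;> abel)
    (by intro r a b; refine Prod.ext ?_ ?_ <;> simp [bkt, smul_sub])

/-- The linear form. -/
noncomputable def alphaL (𝕂 : Type) [RCLike 𝕂] (n p : ℕ) : GA 𝕂 n p →ₗ[𝕂] 𝕂 where
  toFun a := -(trace (a.1 * H0 𝕂 n p) + trace (N0 𝕂 n p * a.2))
  map_add' a b := by simp [Matrix.mul_add, Matrix.add_mul]; ring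
  map_smul' r a := by simp; ring

/-- Projection of matrices to a set of entries. -/
noncomputable def mask {𝕂 : Type} [RCLike 𝕂] {n : ℕ} (s : Fin n → Fin n → Prop)
    [∀ i j, Decidable (s i j)] :
    Matrix (Fin n) (Fin n) 𝕂 →ₗ[𝕂] Matrix (Fin n) (Fin n) 𝕂 where
  toFun u := Matrix.of fun i j => if s i j then u i j else 0
  map_add' u v := by ext i j; simp only [Matrix.of_apply, Matrix.add_apply]; split_ifs <;> simp
  map_smul' r u := by ext i j; simp only [Matrix.of_apply, Matrix.smul_apply]; split_ifs <;> simp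


/-- existence and uniqueness of the Hess connection on `(𝒢_{n,p}(𝕂), ω)` with
`ω = δα_{(H₀,N₀)}`: a unique bilinear map `∇` that is torsion-free, symplectic, and leaves
the transverse Lagrangian subalgebras `L` and `L'` parallel. -/
theorem stmt18 (𝕂 : Type) [RCLike 𝕂] (p k n : ℕ) (hp : 1 ≤ p) (hk : 1 ≤ k)
    (hn : n = k * p) :
    let ω : GA 𝕂 n p → GA 𝕂 n p → 𝕂 := fun a b =>
      -(trace ((bkt a b).1 * H0 𝕂 n p) + trace (N0 𝕂 n p * (bkt a b).2))
    ∃! D : GA 𝕂 n p →ₗ[𝕂] GA 𝕂 n p →ₗ[𝕂] GA 𝕂 n p,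
      (∀ a b : GA 𝕂 n p, D a b - D b a = bkt a b) ∧
      (∀ a b c : GA 𝕂 n p, ω (D a b) c + ω b (D a c) = 0) ∧
      (∀ a : GA 𝕂 n p, ∀ b ∈ Lset 𝕂 n p, D a b ∈ Lset 𝕂 n p) ∧
      (∀ a : GA 𝕂 n p, ∀ b ∈ Lset' 𝕂 n p, D a b ∈ Lset' 𝕂 n p) := by
  intro ω
  have hω : ∀ a b, ω a b = alphaL 𝕂 n p (bktL 𝕂 n p a b) := fun a b => rfl
  have hbb : ∀ a b, bkt a b = bktL 𝕂 n p a b := fun a b => rfl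
  let w : GA 𝕂 n p →ₗ[𝕂] GA 𝕂 n p →ₗ[𝕂] 𝕂 := (bktL 𝕂 n p).compr₂ (alphaL 𝕂 n p)
  have hw' : ∀ a b, ω a b = w a b := fun a b => rfl
  have hB : ∀ a b, bktL 𝕂 n p a b = - bktL 𝕂 n p b a := by
    intro a b
    rw [← hbb, ← hbb]
    refine Prod.ext ?_ ?_ <;> simp [bkt]
  let P : GA 𝕂 n p →ₗ[𝕂] GA 𝕂 n p :=
    LinearMap.prodMap LinearMap.id (mask fun i j => (i : ℕ) / p < (j : ℕ) / p)
  let Q : GA 𝕂 n p →ₗ[𝕂] GA 𝕂 n p :=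
    LinearMap.prodMap 0 (mask fun i j => ¬ ((i : ℕ) / p < (j : ℕ) / p))
  simp only [hw', hbb]
  refine hess_aux (bktL 𝕂 n p) w hB ?_ ?_ ?_ (Lset 𝕂 n p) (Lset' 𝕂 n p) P Q
    ?_ ?_ ?_ ?_ ?_ ?_ ?_ ?_ ?_
  · intro a b
    simp only [w, LinearMap.compr₂_apply]
    rw [hB, map_neg]
  · rintro ⟨x, u⟩ h
    have h' : ∀ (y : Matrix (Fin n) (Fin p) 𝕂) (v : Matrix (Fin n) (Fin n) 𝕂), trace ((u * y - v * x) * H0 𝕂 n p) +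
        trace (N0 𝕂 n p * (u * v - v * u)) = 0 := by
      intro y v
      exact neg_eq_zero.1 (h (y, v))
    have h1 : H0 𝕂 n p * u = 0 := by
      rw [Matrix.ext_iff_trace_mul_right]
      intro y
      have := h' y 0
      simp only [Matrix.zero_mul, Matrix.mul_zero, sub_zero, trace_zero, add_zero] at this
      rw [Matrix.zero_mul, trace_zero, Matrix.mul_assoc, Matrix.trace_mul_comm, this]
    have h2 : N0 𝕂 n p * u - u * N0 𝕂 n p = x * H0 𝕂 n p := by
      rw [Matrix.ext_iff_trace_mul_left]
      intro v
      have := h' 0 v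
      simp only [Matrix.mul_zero, zero_sub, Matrix.neg_mul, trace_neg, Matrix.mul_sub,
        trace_sub] at this
      rw [Matrix.mul_sub, trace_sub, ← Matrix.mul_assoc v x]
      have t1 : trace (v * (N0 𝕂 n p * u)) = trace (N0 𝕂 n p * (u * v)) := by
        rw [Matrix.trace_mul_comm, Matrix.mul_assoc]
      have t2 : trace (v * (u * N0 𝕂 n p)) = trace (N0 𝕂 n p * (v * u)) := by
        rw [← Matrix.mul_assoc, Matrix.trace_mul_comm]
      rw [t1, t2]
      linear_combination this
    obtain ⟨hx, hu⟩ := nondeg_aux hp hk hn x u h1 h2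
    rw [hx, hu]; rfl
  · intro a b c
    simp only [w, LinearMap.compr₂_apply]
    rw [← map_add, ← map_add]
    have := bkt_jacobi a b c
    simp only [hbb] at this
    rw [this, map_zero]
  · intro x i j hij
    simp [P, mask, hij]
  · intro x
    refine ⟨by simp [Q], fun i j hij => ?_⟩
    simp only [Q, mask, LinearMap.prodMap_apply, LinearMap.coe_mk, AddHom.coe_mk, Matrix.of_apply]
    rw [if_neg (by simpa using hij)]
  · intro x
    refine Prod.ext ?_ ?_
    · simp [P, Q]
    · ext i j
      simp only [P, Q, mask, LinearMap.prodMap_apply, LinearMap.coe_mk, AddHom.coe_mk,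
        Matrix.of_apply, Prod.snd_add, Matrix.add_apply]
      split_ifs <;> simp
  · intro x hx
    refine Prod.ext ?_ ?_
    · simp [Q]
    · ext i j
      simp only [Q, mask, LinearMap.prodMap_apply, LinearMap.coe_mk, AddHom.coe_mk,
        Matrix.of_apply]
      split_ifs with h
      · rfl
      · exact hx i j (not_lt.1 h)
  · intro x hx
    refine Prod.ext ?_ ?_
    · simpa [P] using hx.1
    · ext i j
      simp only [P, mask, LinearMap.prodMap_apply, LinearMap.coe_mk, AddHom.coe_mk,
        Matrix.of_apply]
      split_ifs with h
      · exact hx.2 i j h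
      · rfl
  · rintro ⟨x, u⟩ hu ⟨y, v⟩ hv
    change -(trace ((u * y - v * x) * H0 𝕂 n p) +
        trace (N0 𝕂 n p * (u * v - v * u))) = 0
    rw [N0_trace hp, Matrix.trace_mul_comm, Matrix.mul_sub, ← Matrix.mul_assoc, ← Matrix.mul_assoc,
      H0_up hp hk hn u hu, H0_up hp hk hn v hv]
    · simp
    · intro i j hij
      have : (j : ℕ) / p ≤ (i : ℕ) / p + 1 := by
        rw [hij, Nat.add_div_right _ (by omega)]
      rw [Matrix.sub_apply, up_mul u v hu hv i j this, up_mul v u hv hu i j this, sub_zero]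
  · rintro ⟨x, u⟩ ⟨hx, hu⟩ ⟨y, v⟩ ⟨hy, hv⟩
    change -(trace ((u * y - v * x) * H0 𝕂 n p) +
        trace (N0 𝕂 n p * (u * v - v * u))) = 0
    simp only at hx hy
    rw [N0_trace hp, hx, hy]
    · simp
    · intro i j hij
      have : (i : ℕ) / p < (j : ℕ) / p := by
        rw [hij, Nat.add_div_right _ (by omega)]; omega
      rw [Matrix.sub_apply, low_mul u v hu hv i j this, low_mul v u hv hu i j this, sub_zero]
  · rintro ⟨x, u⟩ hu ⟨y, v⟩ hv i j hij
    change (u * v - v * u) i j = 0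
    rw [Matrix.sub_apply, up_mul u v hu hv i j (by omega), up_mul v u hv hu i j (by omega),
      sub_zero]
  · rintro ⟨x, u⟩ ⟨hx, hu⟩ ⟨y, v⟩ ⟨hy, hv⟩
    simp only at hx hy
    refine ⟨?_, fun i j hij => ?_⟩
    · change u * y - v * x = 0
      rw [hx, hy]; simp
    · change (u * v - v * u) i j = 0
      rw [Matrix.sub_apply, low_mul u v hu hv i j hij, low_mul v u hv hu i j hij, sub_zero]
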